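/- arXiv:2010.14249 — 4 statements merged into one kernel-verified Lean document; each statement's English description precedes it below -/
import Mathlib

section
/- Let G be a finite connected simple graph with at least one edge in which every vertex has even degree, and suppose there is a fixed residue i ∈ {0,1,2,3} such that every cycle of G has length congruent to i modulo 4. Then G is regular if and only if G is isomorphic to the cycle graph C_n for some n ≥ 3. -/
namespace SimpleGraph

variable {V : Type*} {G : SimpleGraph V}

/-- The list `L` is the interior of a walk from `a` to `b`. -/
def IsLink (G : SimpleGraph V) (a : V) (L : List V) (b : V) : Prop :=
  (a :: (L ++ [b])).IsChain G.Adj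

@[simp] theorem isLink_nil {a b : V} : G.IsLink a [] b ↔ G.Adj a b := by
  simp [IsLink]

@[simp] theorem isLink_append_cons {a b c : V} {L M : List V} :
    G.IsLink a (L ++ c :: M) b ↔ G.IsLink a L c ∧ G.IsLink c M b := by
  simp only [IsLink, List.append_assoc, List.cons_append]
  exact List.isChain_cons_split

@[simp] theorem isLink_cons {a b c : V} {M : List V} :
    G.IsLink a (c :: M) b ↔ G.Adj a c ∧ G.IsLink c M b := by
  simp [IsLink]

theorem isLink_reverse {a b : V} {L : List V} :
    G.IsLink a L.reverse b ↔ G.IsLink b L a := by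
  have h : a :: (L.reverse ++ [b]) = (b :: (L ++ [a])).reverse := by simp
  rw [IsLink, h, List.isChain_reverse, IsLink]
  simp only [G.adj_comm]

theorem isChain_cons_append_cons {a c : V} {L M : List V} :
    (a :: (L ++ c :: M)).IsChain G.Adj ↔ G.IsLink a L c ∧ (c :: M).IsChain G.Adj :=
  List.isChain_cons_split

theorem IsLink.exists_walk {a b : V} {L : List V} (h : G.IsLink a L b) :
    ∃ p : G.Walk a b, p.support = a :: (L ++ [b]) := by
  induction L generalizing a with
  | nil => exact ⟨(isLink_nil.1 h).toWalk, by simp⟩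
  | cons c L ih =>
    obtain ⟨hac, hL⟩ := isLink_cons.1 h
    obtain ⟨p, hp⟩ := ih hL
    exact ⟨.cons hac p, by simp [hp]⟩

theorem IsLink.exists_isCycle {a : V} {L : List V} (h : G.IsLink a L a) (hL : 2 ≤ L.length)
    (hnd : (a :: L).Nodup) : ∃ p : G.Walk a a, p.IsCycle ∧ p.length = L.length + 1 := by
  match L, hL with
  | b :: L, hL =>
    obtain ⟨hab, hL'⟩ := isLink_cons.1 h
    obtain ⟨p, hp⟩ := hL'.exists_walk
    have hlen : p.length = L.length + 1 := by
      have := p.length_support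
      simp [hp] at this
      omega
    refine ⟨.cons hab p, Walk.isCycle_iff_isPath_tail_and_le_length.2 ⟨?_, ?_⟩, ?_⟩
    · have hpath : p.IsPath := by
        rw [Walk.isPath_def, hp]
        exact (List.perm_append_singleton a (b :: L)).nodup_iff.2 hnd
      simpa using hpath
    · simp only [List.length_cons, Walk.length_cons] at *
      omega
    · simp [hlen]

/-- In a finite graph of minimum degree at least two, some longest path has an initial segment
closing up to a cycle such that every rearrangement of that segment has its first vertex
adjacent only to vertices of the segment. -/
theorem exists_maximal_lollipop [Fintype V] [Nonempty V] [DecidableRel G.Adj]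
    (hdeg : ∀ v, 2 ≤ G.degree v) :
    ∃ (x : V) (B : List V) (u y : V) (R : List V),
      (x :: (B ++ u :: y :: R)).IsChain G.Adj ∧ (x :: (B ++ u :: y :: R)).Nodup ∧ G.Adj y x ∧
      ∀ (v : V) (Q : List V), Q.length = B.length + 2 → (v :: (Q ++ R)).IsChain G.Adj →
        (v :: (Q ++ R)).Nodup → ∀ t, G.Adj v t → t ∈ Q := by
  classical
  let S : Set ℕ := {n | ∃ v : V, ∃ T : List V,
    (v :: T).IsChain G.Adj ∧ (v :: T).Nodup ∧ T.length = n}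
  have hS : S.Nonempty := ⟨0, Classical.arbitrary V, [], by simp⟩
  have hSb : BddAbove S := by
    refine ⟨Fintype.card V, ?_⟩
    rintro n ⟨v, T, -, hnd, rfl⟩
    have := hnd.length_le_card
    simp only [List.length_cons] at this
    omega
  have hlong : ∀ v T, (v :: T).IsChain G.Adj → (v :: T).Nodup → T.length = sSup S →
      ∀ t, G.Adj v t → t ∈ T := by
    intro v T hc hnd hl t hvt
    by_contra ht
    have : T.length + 1 ∈ S := ⟨t, v :: T, by simp [hc, hvt.symm], by
      rw [List.nodup_cons]
      exact ⟨by simp [ht, hvt.ne'], hnd⟩, by simp⟩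
    have := le_csSup hSb this
    omega
  let S' : Set ℕ := {n | ∃ (v : V) (Q : List V) (w : V) (R : List V),
    (v :: (Q ++ w :: R)).IsChain G.Adj ∧ (v :: (Q ++ w :: R)).Nodup ∧
    (Q ++ w :: R).length = sSup S ∧ G.Adj w v ∧ Q.length = n}
  have hSb' : BddAbove S' := by
    refine ⟨sSup S, ?_⟩
    rintro n ⟨v, Q, w, R, -, -, h, -, rfl⟩
    simp at h
    omega
  obtain ⟨n, hn, hnS⟩ : ∃ n, 1 ≤ n ∧ n ∈ S' := by
    obtain ⟨v, T, hc, hnd, hl⟩ := Nat.sSup_mem hS hSb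
    obtain ⟨t, ht, htT⟩ : ∃ t ∈ G.neighborFinset v, t ∉ T.head?.toFinset := by
      apply Finset.exists_mem_notMem_of_card_lt_card
      have := hdeg v
      rw [← G.card_neighborFinset_eq_degree] at this
      have : T.head?.toFinset.card ≤ 1 := by cases T <;> simp
      omega
    rw [mem_neighborFinset] at ht
    obtain ⟨Q, R, rfl⟩ := List.append_of_mem (hlong v T hc hnd hl t ht)
    refine ⟨Q.length, ?_, v, Q, t, R, hc, hnd, hl, ht.symm, rfl⟩
    cases Q with
    | nil => simp at htT
    | cons => simp
  obtain ⟨v, Q, w, R, hc, hnd, hl, hwv, hQ⟩ := Nat.sSup_mem ⟨n, hnS⟩ hSb'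
  have h1 := le_csSup hSb' hnS
  rcases List.eq_nil_or_concat' Q with rfl | ⟨B, u, rfl⟩
  · simp at hQ
    omega
  refine ⟨v, B, u, w, R, by simpa using hc, by simpa using hnd, hwv, ?_⟩
  intro v' Q' hQ' hc' hnd' t ht
  simp only [List.length_append, List.length_cons, List.length_nil] at hl hQ
  have hl' : (Q' ++ R).length = sSup S := by simp; omega
  have htm := hlong v' _ hc' hnd' hl' t ht
  rw [List.mem_append] at htm
  refine htm.resolve_right fun htR ↦ ?_
  obtain ⟨R₁, R₂, rfl⟩ := List.append_of_mem htR
  have : (Q' ++ R₁).length ∈ S' := ⟨v', Q' ++ R₁, t, R₂, by simpa using hc', by simpa using hnd',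
    by simpa using hl', ht.symm, rfl⟩
  have := le_csSup hSb' this
  simp at this
  omega

theorem _root_.List.Nodup.of_count_le {α : Type*} [DecidableEq α] {L M : List α} (hM : M.Nodup)
    (h : ∀ a, L.count a ≤ M.count a) : L.Nodup :=
  List.nodup_iff_count_le_one.2 fun a ↦ (h a).trans (List.nodup_iff_count_le_one.1 hM a)

/-- Rotating the initial segment of a maximal lollipop yields chords of its cycle nested inside one
another; chords that cross would force a cycle of the wrong length. -/
theorem not_maximal_lollipop [Fintype V] [DecidableRel G.Adj] {i k : ℕ} {R : List V}
    (hdeg : ∀ v, 3 ≤ G.degree v)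
    (hcyc : ∀ (a : V) (L : List V), G.IsLink a L a → 2 ≤ L.length → (a :: L).Nodup →
      (L.length + 1) % 4 = i)
    (hmax : ∀ (v : V) (Q : List V), Q.length = k → (v :: (Q ++ R)).IsChain G.Adj →
        (v :: (Q ++ R)).Nodup → ∀ t, G.Adj v t → t ∈ Q)
    {x : V} {B : List V} {u y : V} {D E : List V}
    (hB : G.IsLink x B u) (huy : G.Adj u y) (hyx : G.Adj y x) (hD : G.IsLink y D x)
    (hE : (y :: (E ++ R)).IsChain G.Adj) (hnd : (x :: (B ++ u :: y :: (E ++ R))).Nodup)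
    (hDE : D.Perm E) (hk : (B ++ u :: y :: E).length = k) : False := by
  classical
  induction hn : B.length using Nat.strong_induction_on generalizing x B u y D E with
  | _ n ih =>
  obtain ⟨t, ht, htn⟩ : ∃ t ∈ G.neighborFinset u,
      t ∉ ({y, (x :: B).getLast (by simp)} : Finset V) := by
    apply Finset.exists_mem_notMem_of_card_lt_card
    have := hdeg u
    rw [← G.card_neighborFinset_eq_degree] at this
    exact Finset.card_le_two.trans_lt this
  rw [mem_neighborFinset] at ht
  simp only [Finset.mem_insert, Finset.mem_singleton, not_or] at htn
  obtain ⟨hty, htl⟩ := htn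
  have hmem : t ∈ B.reverse ++ x :: y :: E := by
    refine hmax u (B.reverse ++ x :: y :: E) (by simp at hk ⊢; omega) ?_ ?_ t ht
    · simp [isChain_cons_append_cons, isLink_reverse, hB, hyx.symm, hE]
    · exact hnd.of_count_le fun a ↦ by
        simp only [List.count_append, List.count_cons, List.count_reverse]
        omega
  have hndD : (x :: (B ++ u :: y :: D)).Nodup := hnd.of_count_le fun a ↦ by
    have := hDE.count_eq a
    simp only [List.count_append, List.count_cons]
    omega
  have hA := hcyc x (B ++ [u, y]) (by simp [hB, huy, hyx]) (by simp)
    (hndD.of_count_le fun a ↦ by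
      simp only [List.count_append, List.count_cons, List.count_nil]
      omega)
  simp only [List.mem_append, List.mem_reverse, List.mem_cons, hty, false_or] at hmem
  rcases hmem with htB | rfl | htE
  · obtain ⟨B₁, B₂, rfl⟩ := List.append_of_mem htB
    cases B₂ with
    | nil => simp at htl
    | cons b B₂ =>
    simp only [isLink_append_cons, isLink_cons] at hB
    refine ih B₂.reverse.length (by simp at hn ⊢; omega) (x := u) (B := B₂.reverse) (u := b) (y := t)
      (D := B₁.reverse ++ x :: (D.reverse ++ [y])) (E := B₁.reverse ++ x :: y :: E)
      (isLink_reverse.2 hB.2.2) hB.2.1.symm ht.symm ?_ ?_ ?_ ?_ ?_ rfl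
    · simp [isLink_reverse, hB, hD, huy.symm]
    · simp [isChain_cons_append_cons, isLink_reverse, hB, hyx.symm, hE]
    · exact hnd.of_count_le fun a ↦ by
        simp only [List.count_append, List.count_cons, List.count_reverse]
        omega
    · refine .append_left _ (.cons _ ((List.perm_append_singleton _ _).trans (.cons _ ?_)))
      exact D.reverse_perm.trans hDE
    · simp at hk ⊢
      omega
  · have hB0 : B ≠ [] := by
      rintro rfl
      simp at htl
    have h := hcyc t (B ++ [u]) (by simp [hB, ht]) (by
      have := List.length_pos_iff.2 hB0
      simp; omega) (hndD.of_count_le fun a ↦ by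
        simp only [List.count_append, List.count_cons, List.count_nil]
        omega)
    simp at hA h
    omega
  · obtain ⟨D₁, D₂, rfl⟩ := List.append_of_mem (hDE.mem_iff.2 htE)
    simp only [isLink_append_cons] at hD
    have h1 := hcyc x (B ++ u :: y :: (D₁ ++ t :: D₂)) (by simp [hB, huy, hD]) (by simp; omega) hndD
    have h2 := hcyc u (y :: (D₁ ++ [t])) (by simp [huy, hD, ht.symm]) (by simp)
      (hndD.of_count_le fun a ↦ by
        simp only [List.count_append, List.count_cons, List.count_nil]
        omega)
    have h3 := hcyc x (y :: u :: t :: D₂) (by simp [hyx.symm, huy.symm, hD, ht]) (by simp)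
      (hndD.of_count_le fun a ↦ by
        simp only [List.count_append, List.count_cons]
        omega)
    have h4 := hcyc x (B ++ u :: t :: D₂) (by simp [hB, ht, hD]) (by simp; omega)
      (hndD.of_count_le fun a ↦ by
        simp only [List.count_append, List.count_cons]
        omega)
    simp at hA h1 h2 h3 h4
    omega

/-- A finite graph whose cycle lengths are all congruent modulo four has a vertex of degree at
most two. -/
theorem exists_degree_le_two_of_isCycle_length_mod_four [Fintype V] [Nonempty V]
    [DecidableRel G.Adj] {i : ℕ}
    (hcyc : ∀ (u : V) (c : G.Walk u u), c.IsCycle → c.length % 4 = i) :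
    ∃ v, G.degree v ≤ 2 := by
  by_contra! hdeg
  obtain ⟨x, B, u, y, R, hc, hnd, hyx, hmax⟩ :=
    exists_maximal_lollipop fun v ↦ (hdeg v).le
  simp only [isChain_cons_append_cons, List.isChain_cons_cons] at hc
  refine not_maximal_lollipop (i := i) (D := []) (E := []) hdeg ?_ hmax hc.1 hc.2.1 hyx (isLink_nil.2 hyx)
    hc.2.2 hnd .rfl (by simp)
  intro a L hL h2 hnd
  obtain ⟨p, hp, hlen⟩ := hL.exists_isCycle h2 hnd
  exact hlen ▸ hcyc a p hp

/-- An injective homomorphism from a nonempty regular graph to a connected regular graph of the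
same degree is an isomorphism. -/
theorem Connected.nonempty_iso_of_isRegularOfDegree {W : Type*} [Nonempty W] {H : SimpleGraph W}
    [G.LocallyFinite] [H.LocallyFinite] {r : ℕ} (hG : G.Connected)
    (hGr : G.IsRegularOfDegree r) (hHr : H.IsRegularOfDegree r)
    (f : H →g G) (hf : Function.Injective f) : Nonempty (G ≃g H) := by
  classical
  have hN : ∀ a, (H.neighborFinset a).map ⟨f, hf⟩ = G.neighborFinset (f a) := by
    intro a
    refine Finset.eq_of_subset_of_card_le ?_ ?_
    · intro v hv
      obtain ⟨b, hb, rfl⟩ := Finset.mem_map.1 hv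
      rw [mem_neighborFinset] at hb ⊢
      exact f.map_adj hb
    · simp [hGr (f a), hHr a]
  have hN' : ∀ {a v}, G.Adj (f a) v → ∃ b, H.Adj a b ∧ f b = v := by
    intro a v h
    rw [← mem_neighborFinset, ← hN] at h
    simpa using h
  have hsurj : Function.Surjective f := by
    intro v
    obtain ⟨p⟩ := hG.preconnected (f (Classical.arbitrary W)) v
    generalize Classical.arbitrary W = a at p
    generalize hu : f a = u at p
    induction p generalizing a with
    | nil => exact ⟨a, hu⟩
    | cons h p ih =>
      subst hu
      obtain ⟨b, -, hb⟩ := hN' h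
      exact ih b hb
  refine ⟨RelIso.symm ⟨Equiv.ofBijective f ⟨hf, hsurj⟩, fun {a b} ↦ ⟨fun h ↦ ?_, f.map_adj⟩⟩⟩
  obtain ⟨c, hc, hcb⟩ := hN' h
  exact hf hcb ▸ hc

theorem cycleGraph_isRegularOfDegree_two {n : ℕ} (hn : 3 ≤ n) :
    (cycleGraph n).IsRegularOfDegree 2 := by
  obtain ⟨m, rfl⟩ := Nat.exists_eq_add_of_le' hn
  exact fun _ ↦ cycleGraph_degree_three_le

/-- A finite connected graph that is regular of degree two is a cycle graph. -/
theorem Connected.exists_iso_cycleGraph [Fintype V] [DecidableRel G.Adj]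
    (hG : G.Connected) (hreg : G.IsRegularOfDegree 2) :
    ∃ n, 3 ≤ n ∧ Nonempty (G ≃g cycleGraph n) := by
  have hne := hG.nonempty
  have hac : ¬ G.IsAcyclic := by
    intro hac
    have : Nontrivial V := by
      obtain ⟨v⟩ := hne
      obtain ⟨w, hw⟩ := (G.degree_pos_iff_exists_adj v).1 (by rw [hreg v]; omega)
      exact ⟨v, w, hw.ne⟩
    have h1 := IsTree.minDegree_eq_one_of_nontrivial ⟨hG, hac⟩
    obtain ⟨v, hv⟩ := G.exists_minimal_degree_vertex
    rw [hreg v] at hv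
    omega
  simp only [IsAcyclic, not_forall, not_not] at hac
  obtain ⟨v, p, hp⟩ := hac
  have h3 := hp.three_le_length
  obtain ⟨f⟩ := (cycleGraph_isContained_iff h3).2 ⟨v, p, hp, rfl⟩
  have : Nonempty (Fin p.length) := ⟨⟨0, by omega⟩⟩
  exact ⟨_, h3, hG.nonempty_iso_of_isRegularOfDegree hreg (cycleGraph_isRegularOfDegree_two h3)
    f.toHom f.injective⟩

end SimpleGraph

/-- An Euler graph (finite, connected, at least one edge, all degrees even)
all of whose cycles have length congruent to a fixed `i ∈ {0,1,2,3}` modulo 4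
is regular if and only if it is isomorphic to a cycle graph `C_n` for some `n ≥ 3`. -/
theorem euler_one_cycle_type_regular_iff_cycle_graph
    {V : Type*} [Fintype V] (G : SimpleGraph V) [DecidableRel G.Adj]
    (hconn : G.Connected) (hedge : G.edgeSet.Nonempty)
    (heven : ∀ v : V, Even (G.degree v))
    (i : ℕ) (hi : i < 4)
    (hcyc : ∀ (u : V) (c : G.Walk u u), c.IsCycle → c.length % 4 = i) :
    (∃ r : ℕ, G.IsRegularOfDegree r) ↔
      ∃ n : ℕ, 3 ≤ n ∧ Nonempty (G ≃g SimpleGraph.cycleGraph n) := by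
  constructor
  · rintro ⟨r, hr⟩
    have hne := hconn.nonempty
    obtain ⟨v, hv⟩ := SimpleGraph.exists_degree_le_two_of_isCycle_length_mod_four hcyc
    obtain ⟨e, he⟩ := hedge
    induction e with
    | _ a b =>
    have hpos : 0 < G.degree a := (G.degree_pos_iff_exists_adj a).2 ⟨b, he⟩
    obtain ⟨m, hm⟩ := heven a
    have hv' := hr v
    have ha' := hr a
    obtain rfl : r = 2 := by omega
    exact hconn.exists_iso_cycleGraph hr
  · rintro ⟨n, hn, ⟨e⟩⟩
    refine ⟨2, fun v ↦ ?_⟩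
    rw [← e.degree_eq v]
    exact SimpleGraph.cycleGraph_isRegularOfDegree_two hn (e v)
end

section
/- Let G be a finite connected simple graph in which every vertex has even degree, and suppose the lengths of the cycles of G take exactly two distinct residues modulo 4. Then G is regular if and only if G is bipartite and regular of degree r for some even r > 2. -/
namespace SimpleGraph

variable {V : Type*} {G : SimpleGraph V}

/-- An injective sequence of consecutively adjacent vertices is the support of a path. -/
lemma exists_isPath_of_injOn (g : ℕ → V) (k : ℕ)
    (hinj : ∀ i ≤ k, ∀ j ≤ k, g i = g j → i = j)
    (hadj : ∀ i < k, G.Adj (g i) (g (i + 1))) :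
    ∃ w : G.Walk (g 0) (g k), w.IsPath ∧ w.length = k ∧
      (∀ v ∈ w.support, ∃ i ≤ k, v = g i) ∧
      ∀ e ∈ w.edges, ∃ i < k, e = s(g i, g (i + 1)) := by
  induction k with
  | zero => exact ⟨Walk.nil, by simp⟩
  | succ k ih =>
    obtain ⟨w, hw, hl, hs, he⟩ := ih (fun i hi j hj => hinj i (by omega) j (by omega))
      (fun i hi => hadj i (by omega))
    refine ⟨w.concat (hadj k (by omega)), hw.concat (fun hmem => ?_) _, by simp [hl], ?_, ?_⟩
    · obtain ⟨i, hi, h⟩ := hs _ hmem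
      have := hinj (k + 1) le_rfl i (by omega) h
      omega
    · intro v hv
      rw [Walk.support_concat, List.mem_append, List.mem_singleton] at hv
      rcases hv with hv | rfl
      · obtain ⟨i, hi, rfl⟩ := hs _ hv
        exact ⟨i, by omega, rfl⟩
      · exact ⟨k + 1, le_rfl, rfl⟩
    · intro e hmem
      rw [Walk.edges_concat, List.concat_eq_append, List.mem_append, List.mem_singleton] at hmem
      rcases hmem with hmem | rfl
      · obtain ⟨i, hi, rfl⟩ := he _ hmem
        exact ⟨i, by omega, rfl⟩
      · exact ⟨k, by omega, rfl⟩

/-- `G` contains a cycle with exactly `n` edges. -/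
def HasCycleOfLength (G : SimpleGraph V) (n : ℕ) : Prop :=
  ∃ (u : V) (c : G.Walk u u), c.IsCycle ∧ c.length = n

lemma hasCycleOfLength_of_injOn (g : ℕ → V) (n : ℕ) (hn : 3 ≤ n)
    (hinj : ∀ i < n, ∀ j < n, g i = g j → i = j)
    (hadj : ∀ i, i + 1 < n → G.Adj (g i) (g (i + 1)))
    (hclose : G.Adj (g (n - 1)) (g 0)) : G.HasCycleOfLength n := by
  obtain ⟨w, hw, hl, -, he⟩ := exists_isPath_of_injOn g (n - 1)
    (fun i hi j hj => hinj i (by omega) j (by omega)) (fun i hi => hadj i (by omega))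
  refine ⟨_, Walk.cons hclose w, (Walk.cons_isCycle_iff _ _).2 ⟨hw, fun hmem => ?_⟩, ?_⟩
  · obtain ⟨i, hi, h⟩ := he _ hmem
    rcases Sym2.eq_iff.1 h with ⟨h1, h2⟩ | ⟨h1, h2⟩
    · have := hinj _ (by omega) _ (by omega) h1
      omega
    · have := hinj _ (by omega) _ (by omega) h1
      have := hinj _ (by omega) _ (by omega) h2
      omega
  · rw [Walk.length_cons, hl]; omega

/-- A closed walk of odd length yields an odd cycle. -/
lemma exists_odd_cycle_of_odd_closed (n : ℕ) (hn : Odd n) (g : ℕ → V)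
    (hadj : ∀ i < n, G.Adj (g i) (g (i + 1))) (hclose : g n = g 0) :
    ∃ k, Odd k ∧ G.HasCycleOfLength k := by
  induction n using Nat.strong_induction_on generalizing g with
  | _ n ih =>
  by_cases hinj : ∀ i < n, ∀ j < n, i < j → g i ≠ g j
  · refine ⟨n, hn, hasCycleOfLength_of_injOn g n ?_ ?_ (fun i hi => hadj i (by omega)) ?_⟩
    · by_contra h
      obtain rfl : n = 1 := by obtain ⟨m, rfl⟩ := hn; omega
      exact (hadj 0 (by omega)).ne hclose.symm
    · intro i hi j hj h
      by_contra hij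
      rcases Nat.lt_or_gt_of_ne hij with h' | h'
      · exact hinj i hi j hj h' h
      · exact hinj j hj i hi h' h.symm
    · have hpos := hn.pos
      have := hadj (n - 1) (by omega)
      rwa [Nat.sub_add_cancel hpos, hclose] at this
  · push Not at hinj
    obtain ⟨i, hi, j, hj, hij, h⟩ := hinj
    rcases Nat.even_or_odd (j - i) with he | ho
    · refine ih (n - (j - i)) (by omega) (by grind) (fun t => if t ≤ i then g t else g (t + (j - i)))
        (fun t ht => ?_) ?_
      · rcases lt_trichotomy t i with hlt | rfl | hgt
        · simpa [hlt.le, Nat.succ_le_of_lt hlt] using hadj t (by omega)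
        · have := hadj j hj
          rw [← h] at this
          simpa [show t + 1 + (j - t) = j + 1 by omega] using this
        · have := hadj (t + (j - i)) (by omega)
          simpa [show ¬ t ≤ i by omega, show ¬ t + 1 ≤ i by omega,
            show t + 1 + (j - i) = t + (j - i) + 1 by omega] using this
      · simpa [show ¬ n - (j - i) ≤ i by omega, show n - (j - i) + (j - i) = n by omega] using hclose
    · exact ih (j - i) (by omega) ho (fun t => g (i + t)) (fun t ht => hadj (i + t) (by omega))
        (by simpa [show i + (j - i) = j by omega] using h.symm)

lemma colorable_two_of_forall_cycle_even (h : ∀ n, G.HasCycleOfLength n → Even n) :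
    G.Colorable 2 := by
  rw [two_colorable_iff_forall_loop_even]
  intro u w
  by_contra hodd
  rw [Nat.not_even_iff_odd] at hodd
  obtain ⟨k, hk, hc⟩ := exists_odd_cycle_of_odd_closed w.length hodd w.getVert
    (fun i hi => w.adj_getVert_succ hi) (by simp)
  exact Nat.not_even_iff_odd.2 hk (h k hc)

lemma eq_card_of_hasCycleOfLength [Fintype V] [DecidableRel G.Adj]
    (hconn : G.Connected) (hreg : G.IsRegularOfDegree 2) {n : ℕ} (h : G.HasCycleOfLength n) :
    n = Fintype.card V := by
  classical
  obtain ⟨u, c, hc, rfl⟩ := h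
  have hclosed : ∀ v ∈ c.support, ∀ w, G.Adj v w → w ∈ c.support := by
    intro v hv w hvw
    have h2 := hc.ncard_neighborSet_toSubgraph_eq_two hv
    have heq : c.toSubgraph.neighborSet v = G.neighborSet v := by
      refine Set.eq_of_subset_of_ncard_le (c.toSubgraph.neighborSet_subset v) ?_ (Set.toFinite _)
      rw [h2, Set.ncard_eq_toFinset_card', Set.toFinset_card, card_neighborSet_eq_degree, hreg v]
    have hw : w ∈ c.toSubgraph.neighborSet v := by rw [heq]; exact hvw
    exact c.mem_verts_toSubgraph.1 (c.toSubgraph.edge_vert hw.symm)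
  have hall : ∀ v, v ∈ c.support := by
    intro v
    obtain ⟨w⟩ := hconn.preconnected u v
    have : ∀ {a b : V} (w : G.Walk a b), a ∈ c.support → b ∈ c.support := by
      intro a b w
      induction w with
      | nil => exact id
      | cons hab _ ih => exact fun ha => ih (hclosed _ ha _ hab)
    exact this w c.start_mem_support
  have htail : c.support.tail.toFinset = Finset.univ := by
    ext v
    simp only [List.mem_toFinset, Finset.mem_univ, iff_true]
    rcases (Walk.mem_support_iff c).1 (hall v) with rfl | hv
    · exact Walk.end_mem_tail_support hc.not_nil
    · exact hv
  rw [← Finset.card_univ, ← htail, List.toFinset_card_of_nodup hc.support_nodup]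
  simp

/-- The sequence `f 0, …, f m` is a path of `G`. -/
structure IsPathSeq (G : SimpleGraph V) (f : ℕ → V) (m : ℕ) : Prop where
  inj : ∀ i ≤ m, ∀ j ≤ m, f i = f j → i = j
  adj : ∀ i < m, G.Adj (f i) (f (i + 1))

namespace IsPathSeq

variable {f : ℕ → V} {m : ℕ}

lemma lt_card [Fintype V] (hf : G.IsPathSeq f m) : m < Fintype.card V := by
  obtain ⟨w, hw, hl, -⟩ := exists_isPath_of_injOn f m hf.inj hf.adj
  exact hl ▸ hw.length_lt

/-- Reindexing a path by a sequence of positions which moves along the path or along chords. -/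
lemma hasCycleOfLength (hf : G.IsPathSeq f m) (σ : ℕ → ℕ) (n : ℕ) (hn : 3 ≤ n)
    (hle : ∀ t < n, σ t ≤ m) (hinj : ∀ i < n, ∀ j < n, σ i = σ j → i = j)
    (hstep : ∀ t, t + 1 < n →
      σ (t + 1) = σ t + 1 ∨ σ t = σ (t + 1) + 1 ∨ G.Adj (f (σ t)) (f (σ (t + 1))))
    (hclose : G.Adj (f (σ (n - 1))) (f (σ 0))) : G.HasCycleOfLength n := by
  refine hasCycleOfLength_of_injOn (fun t => f (σ t)) n hn
    (fun i hi j hj h => hinj i hi j hj (hf.inj _ (hle i hi) _ (hle j hj) h)) ?_ hclose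
  intro t ht
  have h1 := hle t (by omega)
  have h2 := hle (t + 1) ht
  rcases hstep t ht with h | h | h
  · have := hf.adj (σ t) (by omega)
    simpa only [h] using this
  · have := hf.adj (σ (t + 1)) (by omega)
    simpa only [h] using this.symm
  · exact h

/-- The fan `i, x, x + 1, …, y, i`. -/
lemma hasCycle_fan (hf : G.IsPathSeq f m) {i x y : ℕ} (hix : i < x) (hxy : x < y) (hym : y ≤ m)
    (hx : G.Adj (f i) (f x)) (hy : G.Adj (f i) (f y)) : G.HasCycleOfLength (y - x + 2) := by
  refine hf.hasCycleOfLength (fun t => if t = 0 then i else x + t - 1) _ (by omega)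
    (by intro t ht; split_ifs <;> omega)
    (by intro a ha b hb; split_ifs <;> omega) ?_ ?_
  · intro t ht
    rcases t with _ | t
    · exact .inr (.inr (by simpa using hx))
    · left; simp; omega
  · simpa [show x + (y - x + 1) - 1 = y by omega] using hy.symm

/-- The cycle `0, …, w, j, j - 1, …, w + 1, 0`. -/
lemma hasCycle_twist (hf : G.IsPathSeq f m) {w j : ℕ} (hw : 0 < w) (hj : w + 1 < j) (hjm : j ≤ m)
    (h0 : G.Adj (f 0) (f (w + 1))) (hwj : G.Adj (f w) (f j)) : G.HasCycleOfLength (j + 1) := by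
  refine hf.hasCycleOfLength (fun t => if t ≤ w then t else j + w + 1 - t) _ (by omega)
    (by intro t ht; split_ifs <;> omega)
    (by intro a ha b hb; split_ifs <;> omega) ?_ ?_
  · intro t ht
    rcases lt_trichotomy t w with h | rfl | h
    · left; split_ifs <;> omega
    · right; right; simpa using hwj
    · right; left; split_ifs <;> omega
  · simpa [show ¬ j ≤ w by omega, show j + w + 1 - j = w + 1 by omega] using h0.symm

/-- The cycle `0, …, w, j, …, q, 0` running upwards from `j` to `q`. -/
lemma hasCycle_up (hf : G.IsPathSeq f m) {w j q : ℕ} (hw : 0 < w) (hj : w < j) (hjq : j ≤ q)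
    (hqm : q ≤ m) (h0 : G.Adj (f 0) (f q)) (hwj : G.Adj (f w) (f j)) :
    G.HasCycleOfLength (w + 2 + (q - j)) := by
  refine hf.hasCycleOfLength (fun t => if t ≤ w then t else j + (t - w - 1)) _ (by omega)
    (by intro t ht; split_ifs <;> omega)
    (by intro a ha b hb; split_ifs <;> omega) ?_ ?_
  · intro t ht
    rcases lt_trichotomy t w with h | rfl | h
    · left; split_ifs <;> omega
    · right; right; simpa using hwj
    · left; split_ifs <;> omega
  · have : ¬ w + 2 + (q - j) - 1 ≤ w := by omega
    simpa only [this, if_false, Nat.zero_le, if_true,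
      show j + (w + 2 + (q - j) - 1 - w - 1) = q by omega] using h0.symm

/-- The cycle `0, …, w, j, …, q, 0` running downwards from `j` to `q`. -/
lemma hasCycle_down (hf : G.IsPathSeq f m) {w j q : ℕ} (hw : 0 < w) (hq : w < q) (hqj : q ≤ j)
    (hjm : j ≤ m) (h0 : G.Adj (f 0) (f q)) (hwj : G.Adj (f w) (f j)) :
    G.HasCycleOfLength (w + 2 + (j - q)) := by
  refine hf.hasCycleOfLength (fun t => if t ≤ w then t else j - (t - w - 1)) _ (by omega)
    (by intro t ht; split_ifs <;> omega)
    (by intro a ha b hb; split_ifs <;> omega) ?_ ?_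
  · intro t ht
    rcases lt_trichotomy t w with h | rfl | h
    · left; split_ifs <;> omega
    · right; right; simpa using hwj
    · right; left; split_ifs <;> omega
  · have : ¬ w + 2 + (j - q) - 1 ≤ w := by omega
    simpa only [this, if_false, Nat.zero_le, if_true,
      show j - (w + 2 + (j - q) - 1 - w - 1) = q by omega] using h0.symm

/-- The cycle `0, w + 1, w, j, …, q, 0` running upwards from `j` to `q`. -/
lemma hasCycle_zigzag_up (hf : G.IsPathSeq f m) {w j q : ℕ} (hw : 0 < w) (hj : w + 1 < j)
    (hjq : j ≤ q) (hqm : q ≤ m) (hp : G.Adj (f 0) (f (w + 1))) (h0 : G.Adj (f 0) (f q))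
    (hwj : G.Adj (f w) (f j)) : G.HasCycleOfLength (q - j + 4) := by
  refine hf.hasCycleOfLength
    (fun t => if t = 0 then 0 else if t ≤ 2 then w + 2 - t else j + (t - 3)) _ (by omega)
    (by intro t ht; split_ifs <;> omega)
    (by intro a ha b hb; split_ifs <;> omega) ?_ ?_
  · intro t ht
    rcases t with _ | _ | _ | t
    · right; right; simpa using hp
    · right; left; simp
    · right; right; simpa using hwj
    · left; simp
      omega
  · simpa [show j + (q - j) = q by omega] using h0.symm

/-- The cycle `0, w + 1, w, j, …, q, 0` running downwards from `j` to `q`. -/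
lemma hasCycle_zigzag_down (hf : G.IsPathSeq f m) {w j q : ℕ} (hw : 0 < w) (hq : w + 1 < q)
    (hqj : q ≤ j) (hjm : j ≤ m) (hp : G.Adj (f 0) (f (w + 1))) (h0 : G.Adj (f 0) (f q))
    (hwj : G.Adj (f w) (f j)) : G.HasCycleOfLength (j - q + 4) := by
  refine hf.hasCycleOfLength
    (fun t => if t = 0 then 0 else if t ≤ 2 then w + 2 - t else j - (t - 3)) _ (by omega)
    (by intro t ht; split_ifs <;> omega)
    (by intro a ha b hb; split_ifs <;> omega) ?_ ?_
  · intro t ht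
    rcases t with _ | _ | _ | t
    · right; right; simpa using hp
    · right; left; simp
    · right; right; simpa using hwj
    · right; left; simp
      omega
  · simpa [show j - (j - q) = q by omega] using h0.symm

/-- Reversing the initial segment `0, …, w` of a path along a chord from `0` to `w + 1`. -/
lemma rotate (hf : G.IsPathSeq f m) {w : ℕ} (hwm : w + 1 ≤ m) (h0 : G.Adj (f 0) (f (w + 1))) :
    G.IsPathSeq (fun t => f (if t ≤ w then w - t else t)) m := by
  refine ⟨fun i hi j hj h => ?_, fun i hi => ?_⟩
  · have := hf.inj _ (by split_ifs <;> omega) _ (by split_ifs <;> omega) h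
    split_ifs at this <;> omega
  · rcases lt_trichotomy i w with h | rfl | h
    · have := (hf.adj (w - (i + 1)) (by omega)).symm
      simpa [h.le, Nat.succ_le_of_lt h, show w - (i + 1) + 1 = w - i by omega] using this
    · simpa using h0
    · simpa [show ¬ i ≤ w by omega, show ¬ i + 1 ≤ w by omega] using hf.adj i hi

/-- If no path is longer, every neighbour of the first vertex lies on the path. -/
lemma exists_eq_of_adj_zero (hf : G.IsPathSeq f m) (hmax : ∀ g, ¬ G.IsPathSeq g (m + 1)) {v : V}
    (hv : G.Adj (f 0) v) : ∃ i ≤ m, v = f i := by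
  by_contra! hne
  refine hmax (fun t => if t = 0 then v else f (t - 1)) ⟨fun i hi j hj h => ?_, fun i hi => ?_⟩
  · rcases i with _ | i <;> rcases j with _ | j
    · rfl
    · exact absurd (by simpa using h) (hne j (by omega))
    · exact absurd (by simpa using h.symm) (hne i (by omega))
    · have := hf.inj i (by omega) j (by omega) (by simpa using h)
      omega
  · rcases i with _ | i
    · simpa using hv.symm
    · simpa using hf.adj i (by omega)

end IsPathSeq

lemma exists_adj_notMem_of_card_lt_degree [Fintype V] [DecidableRel G.Adj] (v : V) (s : Finset V)
    (h : s.card < G.degree v) : ∃ w, G.Adj v w ∧ w ∉ s := by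
  rw [← card_neighborFinset_eq_degree] at h
  obtain ⟨w, hw, hs⟩ := Finset.exists_mem_notMem_of_card_lt_card h
  exact ⟨w, (mem_neighborFinset _ _ _).1 hw, hs⟩

/-- In a finite graph of minimum degree at least four there is a path `f` whose first vertex has
neighbours in positions `w + 1 < q < s`, with a chord from position `w` jumping over `w + 1`. -/
lemma exists_isPathSeq_crossing [Fintype V] [Nonempty V] [DecidableRel G.Adj]
    (hdeg : ∀ v, 4 ≤ G.degree v) :
    ∃ (f : ℕ → V) (m w q s j : ℕ), G.IsPathSeq f m ∧ 0 < w ∧ w + 1 < q ∧ q < s ∧ s ≤ m ∧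
      G.Adj (f 0) (f (w + 1)) ∧ G.Adj (f 0) (f q) ∧ G.Adj (f 0) (f s) ∧
      w + 1 < j ∧ j ≤ m ∧ G.Adj (f w) (f j) := by
  classical
  have hm : ∃ m, (∃ f, G.IsPathSeq f m) ∧ ∀ g, ¬ G.IsPathSeq g (m + 1) := by
    by_contra! hcon
    have : ∀ m, ∃ f, G.IsPathSeq f m := by
      intro m
      induction m with
      | zero => exact ⟨fun _ => Classical.arbitrary V, by intros; omega, by intros; omega⟩
      | succ m ih => obtain ⟨f, hf⟩ := ih; exact hcon m ⟨f, hf⟩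
    obtain ⟨f, hf⟩ := this (Fintype.card V)
    exact hf.lt_card.false
  obtain ⟨m, ⟨f₀, hf₀⟩, hmax⟩ := hm
  have hthird : ∀ f, G.IsPathSeq f m → ∀ T : Finset ℕ, T.card < 4 →
      ∃ i ≤ m, i ∉ T ∧ G.Adj (f 0) (f i) := by
    intro f hf T hT
    obtain ⟨v, hv, hvT⟩ := exists_adj_notMem_of_card_lt_degree (f 0) (T.image f)
      ((Finset.card_image_le.trans_lt hT).trans_le (hdeg _))
    obtain ⟨i, hi, rfl⟩ := hf.exists_eq_of_adj_zero hmax hv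
    exact ⟨i, hi, fun h => hvT (Finset.mem_image_of_mem f h), hv⟩
  have hex : ∃ p, ∃ f, G.IsPathSeq f m ∧ 2 ≤ p ∧ p ≤ m ∧ G.Adj (f 0) (f p) := by
    obtain ⟨i, hi, hiT, hadj⟩ := hthird f₀ hf₀ {0, 1} (by decide)
    simp only [Finset.mem_insert, Finset.mem_singleton, not_or] at hiT
    exact ⟨i, f₀, hf₀, by omega, hi, hadj⟩
  obtain ⟨f, hf, hp2, hpm, hp⟩ := Nat.find_spec hex
  have hmin := fun k => @Nat.find_min _ _ hex k
  generalize Nat.find hex = p at *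
  obtain ⟨w, rfl⟩ : ∃ w, p = w + 1 := ⟨p - 1, by omega⟩
  have hbig : ∀ i ≤ m, i ≠ 1 → i ≠ w + 1 → G.Adj (f 0) (f i) → w + 1 < i := by
    intro i hi h1 hw hadj
    by_contra hlt
    rcases i with _ | i
    · exact hadj.ne rfl
    · exact hmin (i + 1) (by omega) ⟨f, hf, by omega, hi, hadj⟩
  obtain ⟨a, ham, haT, ha⟩ := hthird f hf {1, w + 1} (Finset.card_le_two.trans_lt (by omega))
  obtain ⟨b, hbm, hbT, hb⟩ := hthird f hf {1, w + 1, a} (Finset.card_le_three.trans_lt (by omega))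
  simp only [Finset.mem_insert, Finset.mem_singleton, not_or] at haT hbT
  have ha' := hbig a ham haT.1 haT.2 ha
  have hb' := hbig b hbm hbT.1 hbT.2.1 hb
  have hrot := hf.rotate hpm hp
  obtain ⟨j, hjm, hjT, hj⟩ := hthird _ hrot {1, w + 1} (Finset.card_le_two.trans_lt (by omega))
  simp only [Finset.mem_insert, Finset.mem_singleton, not_or] at hjT
  have hj' : w + 1 < j := by
    by_contra hlt
    rcases j with _ | j
    · exact hj.ne rfl
    · exact hmin (j + 1) (by omega) ⟨_, hrot, by omega, hjm, hj⟩
  have hwj : G.Adj (f w) (f j) := by simpa [show ¬ j ≤ w by omega] using hj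
  rcases Nat.lt_or_gt_of_ne hbT.2.2 with h | h
  · exact ⟨f, m, w, b, a, j, hf, by omega, hb', h, ham, hp, hb, ha, hj', hjm, hwj⟩
  · exact ⟨f, m, w, a, b, j, hf, by omega, ha', h, hbm, hp, ha, hb, hj', hjm, hwj⟩

set_option synthInstance.maxSize 2000 in
/-- The lengths modulo `4` of the cycles in a path with chords as in `exists_isPathSeq_crossing`
cannot all lie in `{a, b}` unless `a` and `b` are even. -/
lemma two_mul_eq_zero_of_crossing : ∀ a b w q : ZMod 4,
    (w + 1 - 1 + 2 = a ∨ w + 1 - 1 + 2 = b) → (q - 1 + 2 = a ∨ q - 1 + 2 = b) →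
    (q - (w + 1) + 2 = a ∨ q - (w + 1) + 2 = b) →
    ∀ s : ZMod 4, (s - 1 + 2 = a ∨ s - 1 + 2 = b) →
    (s - (w + 1) + 2 = a ∨ s - (w + 1) + 2 = b) → (s - q + 2 = a ∨ s - q + 2 = b) →
    ∀ j : ZMod 4, (j - (w + 1) + 2 = a ∨ j - (w + 1) + 2 = b) → (j + 1 = a ∨ j + 1 = b) →
    ((w + 2 + (q - j) = a ∨ w + 2 + (q - j) = b) ∧ (q - j + 4 = a ∨ q - j + 4 = b) ∨
      (w + 2 + (j - q) = a ∨ w + 2 + (j - q) = b) ∧ (j - q + 4 = a ∨ j - q + 4 = b)) →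
    2 * a = 0 ∧ 2 * b = 0 := by
  decide +kernel

/-- If the cycle lengths of a finite graph of minimum degree at least four take at most two residues
modulo `4`, then all cycles are even. -/
lemma even_of_two_residues [Fintype V] [Nonempty V] [DecidableRel G.Adj]
    (hdeg : ∀ v, 4 ≤ G.degree v) {a b : ZMod 4}
    (hres : ∀ n, G.HasCycleOfLength n → (n : ZMod 4) = a ∨ (n : ZMod 4) = b) {n : ℕ}
    (hn : G.HasCycleOfLength n) : Even n := by
  obtain ⟨f, m, w, q, s, j, hf, hw, hq, hs, hsm, hp0, hq0, hs0, hj, hjm, hwj⟩ :=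
    exists_isPathSeq_crossing hdeg
  have h01 : G.Adj (f 0) (f 1) := hf.adj 0 (by omega)
  have hw1 : G.Adj (f w) (f (w + 1)) := hf.adj w (by omega)
  have fan : ∀ {i x y : ℕ}, i < x → x < y → y ≤ m → G.Adj (f i) (f x) → G.Adj (f i) (f y) →
      (y - x + 2 : ZMod 4) = a ∨ (y - x + 2 : ZMod 4) = b := by
    intro i x y hix hxy hym hx hy
    simpa [Nat.cast_sub hxy.le] using hres _ (hf.hasCycle_fan hix hxy hym hx hy)
  have c1 := fan (by omega) (by omega) (by omega) h01 hp0
  have c2 := fan (by omega) (by omega) (by omega) h01 hq0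
  have c3 := fan (by omega) (by omega) (by omega) h01 hs0
  have c4 := fan (by omega) (by omega) (by omega) hp0 hq0
  have c5 := fan (by omega) (by omega) (by omega) hp0 hs0
  have c6 := fan (by omega) (by omega) (by omega) hq0 hs0
  have c7 := fan (by omega) (by omega) (by omega) hw1 hwj
  have c8 := hres _ (hf.hasCycle_twist hw hj hjm hp0 hwj)
  push_cast at c1 c2 c3 c4 c5 c6 c7 c8
  have key : 2 * a = 0 ∧ 2 * b = 0 := by
    refine two_mul_eq_zero_of_crossing a b w q c1 c2 c4 s c3 c5 c6 j c7 c8 ?_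
    rcases le_total j q with hjq | hjq
    · have c9 := hres _ (hf.hasCycle_up hw (by omega) hjq (by omega) hq0 hwj)
      have c10 := hres _ (hf.hasCycle_zigzag_up hw hj hjq (by omega) hp0 hq0 hwj)
      push_cast [Nat.cast_sub hjq] at c9 c10
      exact .inl ⟨c9, c10⟩
    · have c9 := hres _ (hf.hasCycle_down hw (by omega) hjq (by omega) hq0 hwj)
      have c10 := hres _ (hf.hasCycle_zigzag_down hw hq hjq (by omega) hp0 hq0 hwj)
      push_cast [Nat.cast_sub hjq] at c9 c10
      exact .inr ⟨c9, c10⟩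
  have h2n : ((2 * n : ℕ) : ZMod 4) = 0 := by
    push_cast
    rcases hres n hn with h | h <;> rw [h]
    exacts [key.1, key.2]
  rw [ZMod.natCast_eq_zero_iff] at h2n
  exact even_iff_two_dvd.2 (by omega)

end SimpleGraph

/-- Let `G` be a finite connected simple graph with all vertex degrees even,
whose cycle lengths take exactly two distinct residues modulo 4.  Then `G` is regular
if and only if `G` is bipartite (2-colorable) and regular of degree `r` for some even
`r > 2`. -/
theorem euler_two_cycle_types_regular_iff_bipartite_regular
    {V : Type*} [Fintype V] (G : SimpleGraph V) [DecidableRel G.Adj]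
    (hconn : G.Connected)
    (heven : ∀ v : V, Even (G.degree v))
    (hres : ∃ i j : ℕ, i ≠ j ∧
      {r : ℕ | ∃ (u : V) (c : G.Walk u u), c.IsCycle ∧ c.length % 4 = r} = {i, j}) :
    (∃ r : ℕ, G.IsRegularOfDegree r) ↔
      (G.Colorable 2 ∧ ∃ r : ℕ, Even r ∧ 2 < r ∧ G.IsRegularOfDegree r) := by
  classical
  obtain ⟨i, j, hij, hS⟩ := hres
  have hmem : ∀ n, G.HasCycleOfLength n → n % 4 = i ∨ n % 4 = j := by
    rintro n ⟨u, c, hc, rfl⟩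
    have : c.length % 4 ∈ ({i, j} : Set ℕ) := hS ▸ ⟨u, c, hc, rfl⟩
    simpa using this
  have hi : ∃ n, G.HasCycleOfLength n ∧ n % 4 = i := by
    have : i ∈ ({i, j} : Set ℕ) := by simp
    rw [← hS] at this
    obtain ⟨u, c, hc, h⟩ := this
    exact ⟨_, ⟨u, c, hc, rfl⟩, h⟩
  have hj : ∃ n, G.HasCycleOfLength n ∧ n % 4 = j := by
    have : j ∈ ({i, j} : Set ℕ) := by simp
    rw [← hS] at this
    obtain ⟨u, c, hc, h⟩ := this
    exact ⟨_, ⟨u, c, hc, rfl⟩, h⟩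
  obtain ⟨n₁, hn₁, rfl⟩ := hi
  obtain ⟨n₂, hn₂, rfl⟩ := hj
  refine ⟨?_, fun ⟨_, r, _, _, hr⟩ => ⟨r, hr⟩⟩
  rintro ⟨r, hr⟩
  have := hconn.nonempty
  have hreven : Even r := hr (Classical.arbitrary V) ▸ heven _
  have hr0 : r ≠ 0 := by
    rintro rfl
    obtain ⟨u, c, hc, -⟩ := hn₁
    have h := (G.degree_pos_iff_exists_adj u).2 ⟨_, c.adj_snd hc.not_nil⟩
    exact h.ne' (hr u)
  have hr2 : r ≠ 2 := by
    rintro rfl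
    exact hij (by rw [SimpleGraph.eq_card_of_hasCycleOfLength hconn hr hn₁,
      SimpleGraph.eq_card_of_hasCycleOfLength hconn hr hn₂])
  have hr4 : 4 ≤ r := by obtain ⟨k, rfl⟩ := hreven; omega
  refine ⟨SimpleGraph.colorable_two_of_forall_cycle_even fun n hn =>
    SimpleGraph.even_of_two_residues (a := n₁) (b := n₂) (fun v => (hr v).symm ▸ hr4)
      (fun k hk => ?_) hn, r, hreven, by omega, hr⟩
  simpa only [ZMod.natCast_eq_natCast_iff'] using hmem k hk
end

section
/- Let G be a finite connected simple graph with at least one edge in which every vertex has even degree, and suppose the lengths of the cycles of G take at most two distinct residues modulo 4. Then G is regular if and only if either G is isomorphic to a cycle graph C_n with n odd, or G is bipartite and regular of degree r for some even r ≥ 2. -/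
namespace SimpleGraph

variable {V : Type*} {G : SimpleGraph V}

/-- A cyclic sequence of distinct, consecutively adjacent vertices gives a cycle. -/
theorem exists_isCycle_of_injOn {n : ℕ} (hn : 3 ≤ n) (g : ℕ → V)
    (hinj : ∀ i j, i < j → j < n → g i ≠ g j)
    (hadj : ∀ i, i + 1 < n → G.Adj (g i) (g (i + 1)))
    (hclose : G.Adj (g (n - 1)) (g 0)) :
    ∃ (u : V) (c : G.Walk u u), c.IsCycle ∧ c.length = n := by
  refine (cycleGraph_isContained_iff (by omega)).mp ⟨⟨⟨fun i ↦ g i.val, ?_⟩, ?_⟩⟩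
  · intro x y hxy
    wlog hle : y < x
    · exact (this hn g hinj hadj hclose hxy.symm
        (lt_of_le_of_ne (not_lt.mp hle) hxy.ne)).symm
    have hlt : y.val < x.val := hle
    rcases cycleGraph_adj'.mp hxy with h | h
    · rw [Fin.sub_val_of_le hle.le] at h
      have hx : x.val = y.val + 1 := by omega
      have := hadj y.val (by omega)
      simpa [hx] using this.symm
    · rw [Fin.coe_sub_iff_lt.mpr hle] at h
      have hx : x.val = n - 1 := by omega
      have hy : y.val = 0 := by omega
      simpa [hx, hy] using hclose
  · intro x y hxy
    by_contra hne
    rcases lt_or_gt_of_ne hne with h | h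
    · exact hinj x y h y.isLt hxy
    · exact hinj y x h x.isLt hxy.symm

/-- A graph that is not 2-colorable has an odd cycle. -/
theorem exists_odd_isCycle_of_not_colorable_two (h : ¬ G.Colorable 2) :
    ∃ (u : V) (c : G.Walk u u), c.IsCycle ∧ Odd c.length := by
  have hex : ∃ n, Odd n ∧ ∃ (u : V) (w : G.Walk u u), w.length = n := by
    rw [two_colorable_iff_forall_loop_even] at h
    push Not at h
    obtain ⟨u, w, hw⟩ := h
    exact ⟨_, by simpa using hw, u, w, rfl⟩
  classical
  obtain ⟨hodd, u, w, hw⟩ := Nat.find_spec hex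
  have hmin := fun m hm ↦ Nat.find_min hex (m := m) hm
  generalize Nat.find hex = n at *
  have hn1 : n ≠ 1 := by
    rintro rfl
    exact G.loopless.irrefl _ (w.adj_of_length_eq_one hw)
  have h3 : 3 ≤ n := by
    obtain ⟨k, rfl⟩ := hodd
    omega
  suffices ∃ (u : V) (c : G.Walk u u), c.IsCycle ∧ c.length = n by
    obtain ⟨v, c, hc, hcn⟩ := this
    exact ⟨v, c, hc, hcn ▸ hodd⟩
  refine exists_isCycle_of_injOn h3 w.getVert ?_ ?_ ?_
  · intro i j hij hj heq
    by_cases hd : Odd (j - i)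
    · refine hmin (j - i) (by omega) ⟨hd, _,
        (((w.drop i).take (j - i)).copy rfl ?_), ?_⟩
      · rw [Walk.drop_getVert, heq]
        congr 1
        omega
      · simp [Walk.take_length]
        omega
    · refine hmin (n - (j - i)) (by omega) ⟨?_, _,
        ((w.take i).append ((w.drop j).copy heq.symm rfl)), ?_⟩
      · rw [Nat.odd_sub (by omega)]
        simpa [hodd] using hd
      · simp [Walk.take_length, Walk.drop_length]
        omega
  · exact fun i hi ↦ w.adj_getVert_succ (by omega)
  · have := w.adj_getVert_succ (i := n - 1) (by omega)
    rw [show n - 1 + 1 = w.length by omega, Walk.getVert_length] at this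
    rwa [Walk.getVert_zero]

/-- A connected graph that is regular of degree two is isomorphic to every cycle it contains. -/
theorem nonempty_iso_cycleGraph_of_isRegularOfDegree_two [Fintype V] [DecidableRel G.Adj]
    (hconn : G.Connected) (hreg : G.IsRegularOfDegree 2) {u : V} {c : G.Walk u u}
    (hc : c.IsCycle) : Nonempty (G ≃g cycleGraph c.length) := by
  classical
  have h3 := hc.three_le_length
  obtain ⟨f⟩ := (cycleGraph_isContained_iff (G := G) (by omega)).mpr ⟨u, c, hc, rfl⟩
  generalize c.length = n at *
  obtain ⟨n, rfl⟩ : ∃ k, n = k + 3 := ⟨n - 3, by omega⟩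
  have hnbr : ∀ x w, G.Adj (f x) w → ∃ y, (cycleGraph (n + 3)).Adj x y ∧ f y = w := by
    intro x w hw
    have hsub : ((cycleGraph (n + 3)).neighborFinset x).image f ⊆ G.neighborFinset (f x) := by
      intro z hz
      obtain ⟨y, hy, rfl⟩ := Finset.mem_image.mp hz
      simpa using f.toHom.map_adj (by simpa using hy)
    have heq := Finset.eq_of_subset_of_card_le hsub (by
      rw [Finset.card_image_of_injective _ (f := f) f.injective, card_neighborFinset_eq_degree,
        card_neighborFinset_eq_degree, hreg (f x), cycleGraph_degree_three_le])
    have : w ∈ G.neighborFinset (f x) := by simpa using hw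
    rw [← heq] at this
    obtain ⟨y, hy, rfl⟩ := Finset.mem_image.mp this
    exact ⟨y, by simpa using hy, rfl⟩
  have hsurj : Function.Surjective f := by
    intro w
    obtain ⟨p⟩ := hconn.preconnected (f 0) w
    have : ∀ {a b : V} (p : G.Walk a b), (∃ x, f x = a) → ∃ x, f x = b := by
      intro a b p
      induction p with
      | nil => exact id
      | cons hab _ ih =>
        rintro ⟨x, rfl⟩
        obtain ⟨y, -, hy⟩ := hnbr x _ hab
        exact ih ⟨y, hy⟩
    exact this p ⟨0, rfl⟩
  refine ⟨RelIso.symm ⟨Equiv.ofBijective f ⟨f.injective, hsurj⟩, ?_⟩⟩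
  intro x y
  refine ⟨fun h ↦ ?_, fun h ↦ f.toHom.map_adj h⟩
  obtain ⟨z, hz, hzy⟩ := hnbr x _ h
  rwa [← f.injective hzy]

/-- The vertices `f 0, …, f k` form a path. -/
structure IsPathSeq_s5 (G : SimpleGraph V) (f : ℕ → V) (k : ℕ) : Prop where
  ne : ∀ i j, i < j → j ≤ k → f i ≠ f j
  adj : ∀ i, i < k → G.Adj (f i) (f (i + 1))

namespace IsPathSeq_s5

variable {f : ℕ → V} {k : ℕ}

theorem injOn (h : G.IsPathSeq_s5 f k) {i j : ℕ} (hi : i ≤ k) (hj : j ≤ k) (hij : f i = f j) :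
    i = j := by
  by_contra hne
  rcases lt_or_gt_of_ne hne with hlt | hlt
  · exact h.ne i j hlt hj hij
  · exact h.ne j i hlt hi hij.symm

theorem lt_card_s5 [Fintype V] (h : G.IsPathSeq_s5 f k) : k < Fintype.card V := by
  have := Fintype.card_le_of_injective (fun i : Fin (k + 1) ↦ f i)
    (fun i j hij ↦ Fin.ext (h.injOn (by omega) (by omega) hij))
  simpa using this

theorem adj_pred (h : G.IsPathSeq_s5 f k) {i j : ℕ} (hij : i + 1 = j) (hj : j ≤ k) :
    G.Adj (f j) (f i) := by
  subst hij
  exact (h.adj i hj).symm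

theorem adj_succ (h : G.IsPathSeq_s5 f k) {i j : ℕ} (hij : i + 1 = j) (hj : j ≤ k) :
    G.Adj (f i) (f j) :=
  (h.adj_pred hij hj).symm

/-- Prepending a new neighbor of the first vertex. -/
theorem cons (h : G.IsPathSeq_s5 f k) {w : V} (hw : G.Adj w (f 0)) (hne : ∀ i ≤ k, f i ≠ w) :
    G.IsPathSeq_s5 (fun j ↦ if j = 0 then w else f (j - 1)) (k + 1) where
  ne i j hij hj := by
    split_ifs with h1 h2
    · omega
    · exact (hne _ (by omega)).symm
    · omega
    · exact h.ne _ _ (by omega) (by omega)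
  adj i hi := by
    split_ifs with h1 h2
    · contradiction
    · simpa [h1] using hw
    · contradiction
    · exact h.adj_succ (by omega) (by omega)

/-- Rotation of a path along an edge from its first vertex. -/
theorem rotate_s5 (h : G.IsPathSeq_s5 f k) {i : ℕ} (hi : i ≤ k) (hadj : G.Adj (f 0) (f i)) :
    G.IsPathSeq_s5 (fun j ↦ if j < i then f (i - 1 - j) else f j) k where
  ne a b hab hb := by
    intro heq
    split_ifs at heq <;>
    · have := h.injOn (by omega) (by omega) heq
      omega
  adj j hj := by
    split_ifs with h1 h2
    · exact h.adj_pred (by omega) (by omega)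
    · rwa [show i - 1 - j = 0 by omega, show j + 1 = i by omega]
    · omega
    · exact h.adj_succ (by omega) (by omega)

/-- Two edges from the first vertex of a path close up a cycle. -/
theorem exists_isCycle_fan (h : G.IsPathSeq_s5 f k) {a b : ℕ} (ha : 1 ≤ a) (hab : a < b)
    (hb : b ≤ k) (hadja : G.Adj (f 0) (f a)) (hadjb : G.Adj (f 0) (f b)) :
    ∃ (u : V) (c : G.Walk u u), c.IsCycle ∧ c.length = b - a + 2 := by
  refine exists_isCycle_of_injOn (by omega)
    (fun j ↦ if j = 0 then f 0 else f (a + j - 1)) ?_ ?_ ?_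
  · intro x y hxy hy heq
    split_ifs at heq <;>
    · first
      | omega
      | have := h.injOn (by omega) (by omega) heq
        omega
  · intro x hx
    split_ifs with h1
    · contradiction
    · rwa [show a + (x + 1) - 1 = a by omega]
    · contradiction
    · exact h.adj_succ (by omega) (by omega)
  · rw [if_pos rfl, if_neg (by omega), show a + (b - a + 2 - 1) - 1 = b by omega]
    exact hadjb.symm

/-- The cycle that runs through the initial segment of length `i`, jumps to `f t`, descends
to `f m` and returns to `f 0`. -/
theorem exists_isCycle_initial (h : G.IsPathSeq_s5 f k) {i m t : ℕ} (hi : 1 < i) (him : i < m)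
    (hmt : m ≤ t) (ht : t ≤ k) (hadjm : G.Adj (f 0) (f m))
    (hadjt : G.Adj (f (i - 1)) (f t)) :
    ∃ (u : V) (c : G.Walk u u), c.IsCycle ∧ c.length = i + (t - m) + 1 := by
  refine exists_isCycle_of_injOn (by omega)
    (fun j ↦ if j < i then f j else f (t - (j - i))) ?_ ?_ ?_
  · intro x y hxy hy heq
    split_ifs at heq <;>
    · first
      | omega
      | have := h.injOn (by omega) (by omega) heq
        omega
  · intro x hx
    split_ifs with h1 h2
    · exact h.adj_succ (by omega) (by omega)
    · rwa [show x = i - 1 by omega, show t - (i - 1 + 1 - i) = t by omega]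
    · omega
    · exact h.adj_pred (by omega) (by omega)
  · rw [if_neg (by omega), if_pos (by omega),
      show t - (i + (t - m) + 1 - 1 - i) = m by omega]
    exact hadjm.symm

/-- The cycle that runs through the segment from `f i` to `f t` closed by a chord. -/
theorem exists_isCycle_segment (h : G.IsPathSeq_s5 f k) {i t : ℕ} (hit : i + 2 ≤ t) (ht : t ≤ k)
    (hadj : G.Adj (f i) (f t)) :
    ∃ (u : V) (c : G.Walk u u), c.IsCycle ∧ c.length = t - i + 1 := by
  refine exists_isCycle_of_injOn (by omega) (fun j ↦ f (i + j)) ?_ ?_ ?_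
  · intro x y hxy hy
    exact h.ne _ _ (by omega) (by omega)
  · intro x hx
    exact h.adj_succ (by omega) (by omega)
  · rw [show i + (t - i + 1 - 1) = t by omega]
    exact hadj.symm

/-- The cycle through `f 0`, `f i`, `f (i - 1)` and the segment from `f t` down to `f m`. -/
theorem exists_isCycle_crossing (h : G.IsPathSeq_s5 f k) {i m t : ℕ} (hi : 1 < i) (him : i < m)
    (hmt : m ≤ t) (ht : t ≤ k) (hadji : G.Adj (f 0) (f i)) (hadjm : G.Adj (f 0) (f m))
    (hadjt : G.Adj (f (i - 1)) (f t)) :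
    ∃ (u : V) (c : G.Walk u u), c.IsCycle ∧ c.length = t - m + 4 := by
  refine exists_isCycle_of_injOn (by omega)
    (fun j ↦ if j = 0 then f 0 else if j = 1 then f i else if j = 2 then f (i - 1)
      else f (t - (j - 3))) ?_ ?_ ?_
  · intro x y hxy hy heq
    split_ifs at heq <;>
    · first
      | omega
      | have := h.injOn (by omega) (by omega) heq
        omega
  · intro x hx
    match x with
    | 0 => simpa using hadji
    | 1 => simpa using h.adj_pred (i := i - 1) (by omega) (by omega)
    | 2 => simpa using hadjt
    | x + 3 => simpa using h.adj_pred (i := t - (x + 1)) (j := t - x) (by omega) (by omega)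
  · rw [if_pos rfl, if_neg (by omega), if_neg (by omega), if_neg (by omega),
      show t - (t - m + 4 - 1 - 3) = m by omega]
    exact hadjm.symm

end IsPathSeq_s5

/-- The cycle lengths produced by three fan chords and a crossing path are incompatible with two
residue classes of which one is odd. -/
theorem mod_four_contradiction {i j a b m t : ℕ} (hi : Odd i) (ha1 : a ≠ 1) (ha0 : 1 ≤ a)
    (hab : a < b) (hbm : b < m) (hmt : m ≤ t)
    (c1a : (a - 1 + 2) % 4 = i ∨ (a - 1 + 2) % 4 = j)
    (c1b : (b - 1 + 2) % 4 = i ∨ (b - 1 + 2) % 4 = j)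
    (c1m : (m - 1 + 2) % 4 = i ∨ (m - 1 + 2) % 4 = j)
    (cab : (b - a + 2) % 4 = i ∨ (b - a + 2) % 4 = j)
    (cam : (m - a + 2) % 4 = i ∨ (m - a + 2) % 4 = j)
    (cbm : (m - b + 2) % 4 = i ∨ (m - b + 2) % 4 = j)
    (cinit : (a + (t - m) + 1) % 4 = i ∨ (a + (t - m) + 1) % 4 = j)
    (cseg : (t - a + 2) % 4 = i ∨ (t - a + 2) % 4 = j)
    (ccross : (t - m + 4) % 4 = i ∨ (t - m + 4) % 4 = j) : False := by
  rw [Nat.odd_iff] at hi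
  obtain ⟨x, rfl⟩ : ∃ x, a = x + 1 := ⟨a - 1, by omega⟩
  obtain ⟨y, rfl⟩ := Nat.exists_eq_add_of_le hab.le
  obtain ⟨z, rfl⟩ := Nat.exists_eq_add_of_le hbm.le
  obtain ⟨s, rfl⟩ := Nat.exists_eq_add_of_le hmt
  rw [show x + 1 - 1 + 2 = x + 2 by omega] at c1a
  rw [show x + 1 + y - 1 + 2 = x + y + 2 by omega] at c1b
  rw [show x + 1 + y + z - 1 + 2 = x + y + z + 2 by omega] at c1m
  rw [show x + 1 + y - (x + 1) + 2 = y + 2 by omega] at cab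
  rw [show x + 1 + y + z - (x + 1) + 2 = y + z + 2 by omega] at cam
  rw [show x + 1 + y + z - (x + 1 + y) + 2 = z + 2 by omega] at cbm
  rw [show x + 1 + (x + 1 + y + z + s - (x + 1 + y + z)) + 1 = x + s + 2 by omega] at cinit
  rw [show x + 1 + y + z + s - (x + 1) + 2 = y + z + s + 2 by omega] at cseg
  rw [show x + 1 + y + z + s - (x + 1 + y + z) + 4 = s + 4 by omega] at ccross
  clear hab hbm hmt ha0 ha1
  have key : x % 4 = 0 ∨ (y + z) % 4 = 0 := by
    clear cinit cseg ccross
    rcases c1a with h1 | h1 <;> rcases c1b with h2 | h2 <;> rcases c1m with h3 | h3 <;>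
      rcases cab with h4 | h4 <;> rcases cam with h5 | h5 <;> rcases cbm with h6 | h6 <;> omega
  clear c1b cab cbm c1m
  rcases key with h | h <;> omega

/-- In a finite graph of minimum degree at least four, the cycle lengths do not lie in two residue
classes modulo 4 of which one is odd. -/
theorem exists_isCycle_length_mod_four_ne [Fintype V] [Nonempty V] [DecidableRel G.Adj]
    (hdeg : ∀ v, 4 ≤ G.degree v) {i j : ℕ} (hi : Odd i) :
    ∃ (u : V) (c : G.Walk u u), c.IsCycle ∧ c.length % 4 ≠ i ∧ c.length % 4 ≠ j := by
  classical
  by_contra! hres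
  have hcyc : ∀ n, (∃ (u : V) (c : G.Walk u u), c.IsCycle ∧ c.length = n) →
      n % 4 = i ∨ n % 4 = j := by
    rintro n ⟨u, c, hc, rfl⟩
    exact or_iff_not_imp_left.mpr (hres u c hc)
  obtain ⟨k, ⟨f₀, hf₀⟩, hkmax⟩ : ∃ k, (∃ f, G.IsPathSeq_s5 f k) ∧ ∀ f, ¬ G.IsPathSeq_s5 f (k + 1) := by
    by_contra! hcon
    have hall : ∀ k, ∃ f, G.IsPathSeq_s5 f k := by
      intro k
      induction k with
      | zero => exact ⟨fun _ ↦ Classical.arbitrary V, by intros; omega, by intros; omega⟩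
      | succ k ih => exact hcon k ih
    obtain ⟨f, hf⟩ := hall (Fintype.card V)
    exact lt_irrefl _ hf.lt_card_s5
  have hnbr : ∀ f, G.IsPathSeq_s5 f k → ∀ w, G.Adj (f 0) w → ∃ a ≤ k, f a = w := by
    intro f hf w hw
    by_contra! hcon
    exact hkmax _ (hf.cons hw.symm hcon)
  obtain ⟨N, hN⟩ : ∃ N : (ℕ → V) → Finset ℕ, ∀ f a, a ∈ N f ↔ a ≤ k ∧ G.Adj (f 0) (f a) :=
    ⟨fun f ↦ {a ∈ Finset.range (k + 1) | G.Adj (f 0) (f a)}, by simp⟩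
  have hcard : ∀ f, G.IsPathSeq_s5 f k → 4 ≤ (N f).card := by
    intro f hf
    refine (hdeg (f 0)).trans ?_
    rw [← card_neighborFinset_eq_degree]
    refine (Finset.card_le_card fun w hw ↦ ?_).trans (Finset.card_image_le (f := f))
    obtain ⟨a, ha, rfl⟩ := hnbr f hf w (by simpa using hw)
    exact Finset.mem_image.mpr ⟨a, (hN f a).mpr ⟨ha, by simpa using hw⟩, rfl⟩
  have hmax : ∀ f, G.IsPathSeq_s5 f k → ∃ m ∈ N f, ∀ a ∈ N f, a ≤ m := fun f hf ↦
    (N f).exists_max_image id (Finset.card_pos.mp (by have := hcard f hf; omega))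
  have hex : ∃ m f, G.IsPathSeq_s5 f k ∧ m ∈ N f ∧ ∀ a ∈ N f, a ≤ m :=
    let ⟨m, hm⟩ := hmax f₀ hf₀
    ⟨m, f₀, hf₀, hm⟩
  obtain ⟨f, hf, hmN, hmle⟩ := Nat.find_spec hex
  have hmin := fun m hm ↦ Nat.find_min hex (m := m) hm
  generalize Nat.find hex = m at *
  obtain ⟨hmk, hm⟩ := (hN f m).mp hmN
  obtain ⟨a, ha, b, hb, hab⟩ : ∃ a ∈ (N f \ {1, m}), ∃ b ∈ (N f \ {1, m}), a < b := by
    have hlt : 1 < (N f \ {1, m}).card := by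
      have h1 := Finset.le_card_sdiff {1, m} (N f)
      have h2 := Finset.card_le_two (a := 1) (b := m)
      have h3 := hcard f hf
      omega
    obtain ⟨a, ha, b, hb, hne⟩ := Finset.one_lt_card.mp hlt
    rcases lt_or_gt_of_ne hne with h | h
    · exact ⟨a, ha, b, hb, h⟩
    · exact ⟨b, hb, a, ha, h⟩
  simp only [Finset.mem_sdiff, Finset.mem_insert, Finset.mem_singleton, not_or] at ha hb
  obtain ⟨haN, ha1, -⟩ := ha
  obtain ⟨hbN, -, hbm⟩ := hb
  have hbm' := lt_of_le_of_ne (hmle b hbN) hbm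
  obtain ⟨hak, haadj⟩ := (hN f a).mp haN
  obtain ⟨hbk, hbadj⟩ := (hN f b).mp hbN
  have ha0 : a ≠ 0 := by
    rintro rfl
    exact haadj.ne rfl
  have h1adj : G.Adj (f 0) (f 1) := hf.adj 0 (by omega)
  obtain ⟨t, hmt, htk, htadj⟩ : ∃ t, m ≤ t ∧ t ≤ k ∧ G.Adj (f (a - 1)) (f t) := by
    have hrot := hf.rotate_s5 hak haadj
    obtain ⟨t, htN, htmax⟩ := hmax _ hrot
    have hmt : m ≤ t := by
      by_contra hlt
      exact hmin t (not_le.mp hlt) ⟨_, hrot, htN, htmax⟩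
    obtain ⟨htk, htadj⟩ := (hN _ t).mp htN
    refine ⟨t, hmt, htk, ?_⟩
    rwa [if_pos (by omega), if_neg (by omega)] at htadj
  refine mod_four_contradiction hi ha1 (by omega) hab hbm' hmt
    (hcyc _ (hf.exists_isCycle_fan le_rfl (by omega) hak h1adj haadj))
    (hcyc _ (hf.exists_isCycle_fan le_rfl (by omega) hbk h1adj hbadj))
    (hcyc _ (hf.exists_isCycle_fan le_rfl (by omega) hmk h1adj hm))
    (hcyc _ (hf.exists_isCycle_fan (by omega) hab hbk haadj hbadj))
    (hcyc _ (hf.exists_isCycle_fan (by omega) (by omega) hmk haadj hm))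
    (hcyc _ (hf.exists_isCycle_fan (by omega) hbm' hmk hbadj hm))
    (hcyc _ (hf.exists_isCycle_initial (by omega) (by omega) hmt htk hm htadj))
    ?_
    (hcyc _ (hf.exists_isCycle_crossing (by omega) (by omega) hmt htk haadj hm htadj))
  have := hcyc _ (hf.exists_isCycle_segment (by omega) htk htadj)
  rwa [show t - (a - 1) + 1 = t - a + 2 by omega] at this

end SimpleGraph

/-- Let `G` be a finite connected simple graph with at least one edge and all
vertex degrees even, whose cycle lengths take at most two distinct residues modulo 4.
Then `G` is regular if and only if either `G` is isomorphic to a cycle graph `C_n` with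
`n` odd, or `G` is bipartite (2-colorable) and regular of degree `r` for some even
`r ≥ 2`. -/
theorem euler_at_most_two_cycle_types_regular_iff
    {V : Type*} [Fintype V] (G : SimpleGraph V) [DecidableRel G.Adj]
    (hconn : G.Connected) (hedge : G.edgeSet.Nonempty)
    (heven : ∀ v : V, Even (G.degree v))
    (hres : ∃ i j : ℕ,
      {r : ℕ | ∃ (u : V) (c : G.Walk u u), c.IsCycle ∧ c.length % 4 = r} ⊆ {i, j}) :
    (∃ r : ℕ, G.IsRegularOfDegree r) ↔
      ((∃ n : ℕ, 3 ≤ n ∧ Odd n ∧ Nonempty (G ≃g SimpleGraph.cycleGraph n)) ∨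
        (G.Colorable 2 ∧ ∃ r : ℕ, Even r ∧ 2 ≤ r ∧ G.IsRegularOfDegree r)) := by
  obtain ⟨i, j, hij⟩ := hres
  have hcyc : ∀ (u : V) (c : G.Walk u u), c.IsCycle → c.length % 4 = i ∨ c.length % 4 = j :=
    fun u c hc ↦ by simpa using hij ⟨u, c, hc, rfl⟩
  constructor
  · rintro ⟨r, hreg⟩
    obtain ⟨v⟩ := hconn.nonempty
    have hr : Even r := hreg v ▸ heven v
    have hr0 : r ≠ 0 := by
      rintro rfl
      obtain ⟨e, he⟩ := hedge
      induction e with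
      | h x y =>
        have := (G.degree_pos_iff_exists_adj x).mpr ⟨y, he⟩
        rw [hreg x] at this
        exact lt_irrefl _ this
    have hr2 : 2 ≤ r := by
      obtain ⟨s, rfl⟩ := hr
      omega
    by_cases hcol : G.Colorable 2
    · exact Or.inr ⟨hcol, r, hr, hr2, hreg⟩
    left
    obtain ⟨u, c, hc, hodd⟩ := SimpleGraph.exists_odd_isCycle_of_not_colorable_two hcol
    rcases hr2.eq_or_lt with rfl | hlt
    · exact ⟨c.length, hc.three_le_length, hodd,
        SimpleGraph.nonempty_iso_cycleGraph_of_isRegularOfDegree_two hconn hreg hc⟩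
    exfalso
    have hdeg : ∀ w, 4 ≤ G.degree w := by
      intro w
      rw [hreg w]
      obtain ⟨s, rfl⟩ := hr
      omega
    have hodd4 : Odd (c.length % 4) := by
      rw [Nat.odd_iff] at hodd ⊢
      omega
    have : Nonempty V := ⟨v⟩
    rcases hcyc u c hc with h | h
    · obtain ⟨w, d, hd, h1, h2⟩ :=
        SimpleGraph.exists_isCycle_length_mod_four_ne hdeg (j := j) (h ▸ hodd4)
      exact (hcyc w d hd).elim h1 h2
    · obtain ⟨w, d, hd, h1, h2⟩ :=
        SimpleGraph.exists_isCycle_length_mod_four_ne hdeg (j := i) (h ▸ hodd4)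
      exact (hcyc w d hd).elim h2 h1
  · rintro (⟨n, hn, -, ⟨e⟩⟩ | ⟨-, r, -, -, hreg⟩)
    · obtain ⟨n, rfl⟩ : ∃ k, n = k + 3 := ⟨n - 3, by omega⟩
      refine ⟨2, fun v ↦ ?_⟩
      rw [← e.degree_eq v, SimpleGraph.cycleGraph_degree_three_le]
    · exact ⟨r, hreg⟩
end

section
/- Let G be a simple graph in which every cycle has length congruent to 0 modulo 4. If C₁ and C₂ are cycles in G whose edge sets intersect exactly in the edge set of a path P of length m ≥ 1 and whose vertex (support) sets intersect exactly in the vertex set of P, then m is even. -/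
namespace SimpleGraph.Walk

variable {V : Type*} {G : SimpleGraph V}

/-- A path whose edges all lie on a path with the same starting point is a prefix of it. -/
lemma IsPath.exists_eq_append_of_edges_subset {u v w : V} {r : G.Walk u w} (hr : r.IsPath)
    {p : G.Walk u v} (hp : p.IsPath) (h : p.edges ⊆ r.edges) :
    ∃ q : G.Walk v w, r = p.append q := by
  induction p with
  | nil => exact ⟨r, rfl⟩
  | @cons u x v hux p ih =>
    have hmem : s(u, x) ∈ r.edges := h (by simp)
    cases r with
    | nil => simp at hmem
    | @cons _ y _ huy r =>
      obtain rfl : x = y := by simpa using hr.eq_snd_of_mem_edges hmem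
      rw [cons_isPath_iff] at hr hp
      have hsub : p.edges ⊆ r.edges := by
        intro e he
        have her := h (by simp [he] : e ∈ (cons hux p).edges)
        rw [edges_cons, List.mem_cons] at her
        rcases her with rfl | her
        · exact absurd (p.fst_mem_support_of_mem_edges he) hp.2
        · exact her
      obtain ⟨q, rfl⟩ := ih hr.1 hp.1 hsub
      exact ⟨q, rfl⟩

/-- A cycle through the edge `uw` can be rotated and reversed so as to start with that edge. -/
lemma IsCycle.exists_cons_of_mem_edges {a u w : V} {c : G.Walk a a} (hc : c.IsCycle)
    (huw : G.Adj u w) (h : s(u, w) ∈ c.edges) :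
    ∃ r : G.Walk w u, (cons huw r).IsCycle ∧ (cons huw r).edges.Perm c.edges := by
  classical
  have hu : u ∈ c.support := c.fst_mem_support_of_mem_edges h
  have hperm := (c.rotate_edges u hu).perm
  have hd : (c.rotate u hu).IsCycle := (isCycle_rotate hu).2 hc
  generalize c.rotate u hu = d at hperm hd
  cases d with
  | nil => exact absurd rfl hd.ne_nil
  | @cons _ x _ hux r =>
    have hmem := hperm.mem_iff.2 h
    by_cases hxw : x = w
    · subst hxw
      exact ⟨r, hd, hperm⟩
    have hr := ((cons_isCycle_iff _ _).1 hd).1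
    have hmem' : s(u, w) ∈ r.edges := by
      rw [edges_cons, List.mem_cons] at hmem
      rcases hmem with hmem | hmem
      · exact absurd (Sym2.congr_right.1 hmem).symm hxw
      · exact hmem
    have hw : w = r.reverse.snd := hr.reverse.eq_snd_of_mem_edges (by simpa using hmem')
    have hd' := hd.reverse
    have hperm' : (cons hux r).reverse.edges.Perm c.edges := by
      rw [edges_reverse]
      exact (List.reverse_perm _).trans hperm
    rw [reverse_cons] at hd' hperm'
    generalize r.reverse = s at hw hd' hperm'
    cases s with
    | nil => exact absurd hux (G.loopless.irrefl _)
    | @cons _ y _ huy s =>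
      obtain rfl : w = y := by simpa using hw
      exact ⟨s.append (cons hux.symm nil), hd', hperm'⟩

/-- A nontrivial path contained in a cycle has a complementary path. -/
lemma IsCycle.exists_append_of_edges_subset {a u v : V} {c : G.Walk a a} (hc : c.IsCycle)
    {p : G.Walk u v} (hp : p.IsPath) (hnil : ¬ p.Nil) (h : p.edges ⊆ c.edges) :
    ∃ q : G.Walk v u, q.IsPath ∧ (p.append q).IsCycle ∧ (p.append q).edges.Perm c.edges := by
  cases p with
  | nil => simp at hnil
  | @cons _ w _ huw p =>
    obtain ⟨r, hr, hperm⟩ := hc.exists_cons_of_mem_edges huw (h (by simp))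
    have hp' := (cons_isPath_iff _ _).1 hp
    have hrp := ((cons_isCycle_iff _ _).1 hr).1
    obtain ⟨q, rfl⟩ := hrp.exists_eq_append_of_edges_subset hp'.1 (by
      intro e he
      have her := hperm.mem_iff.2 (h (by simp [he] : e ∈ (cons huw p).edges))
      rw [edges_cons, List.mem_cons] at her
      rcases her with rfl | her
      · exact absurd (p.fst_mem_support_of_mem_edges he) hp'.2
      · exact her)
    exact ⟨q, hrp.of_append_right, hr, hperm⟩

lemma mem_support_of_edges_subset {u v u' v' x : V} {p : G.Walk u v} {q : G.Walk u' v'}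
    (hnil : ¬ p.Nil) (h : p.edges ⊆ q.edges) (hx : x ∈ p.support) : x ∈ q.support := by
  obtain ⟨e, he, hxe⟩ := (mem_support_iff_exists_mem_edges_of_not_nil hnil).1 hx
  exact mem_support_of_mem_edges (h he) hxe

end SimpleGraph.Walk


/-- In a simple graph all of whose cycles have length `≡ 0 (mod 4)`, if two
cycles intersect exactly in a path of length `m ≥ 1` (both in edges and in vertices),
then `m` is even. -/
theorem path_intersection_even_of_all_cycles_zero_mod_four
    {V : Type*} (G : SimpleGraph V)
    (hcyc : ∀ (w : V) (c : G.Walk w w), c.IsCycle → c.length % 4 = 0)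
    {a b u v : V} (m : ℕ)
    (c₁ : G.Walk a a) (c₂ : G.Walk b b) (p : G.Walk u v)
    (hc₁ : c₁.IsCycle) (hc₂ : c₂.IsCycle) (hp : p.IsPath)
    (hm : p.length = m) (hm1 : 1 ≤ m)
    (hedges : {e : Sym2 V | e ∈ c₁.edges} ∩ {e : Sym2 V | e ∈ c₂.edges}
      = {e : Sym2 V | e ∈ p.edges})
    (hsupp : {x : V | x ∈ c₁.support} ∩ {x : V | x ∈ c₂.support}
      = {x : V | x ∈ p.support}) :
    Even m := by
  have hnil : ¬ p.Nil := by
    rw [← SimpleGraph.Walk.length_eq_zero_iff]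
    omega
  have hpc (e : Sym2 V) : e ∈ c₁.edges ∧ e ∈ c₂.edges ↔ e ∈ p.edges := Set.ext_iff.1 hedges e
  have hpv (x : V) : x ∈ c₁.support ∧ x ∈ c₂.support ↔ x ∈ p.support := Set.ext_iff.1 hsupp x
  obtain ⟨q₁, hq₁, hd₁, hperm₁⟩ :=
    hc₁.exists_append_of_edges_subset hp hnil fun e he ↦ ((hpc e).2 he).1
  obtain ⟨q₂, hq₂, hd₂, hperm₂⟩ :=
    hc₂.exists_append_of_edges_subset hp hnil fun e he ↦ ((hpc e).2 he).2
  have huv : u ≠ v := by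
    rintro rfl
    exact hnil (SimpleGraph.Walk.isPath_iff_nil.1 hp)
  have hedisj : q₁.edges.Disjoint q₂.edges := by
    intro e he₁ he₂
    have hep : e ∈ p.edges :=
      (hpc e).1 ⟨hperm₁.subset (by simp [he₁]), hperm₂.subset (by simp [he₂])⟩
    have hnd := hd₁.edges_nodup
    rw [SimpleGraph.Walk.edges_append, List.nodup_append'] at hnd
    exact hnd.2.2 hep he₁
  have hsdisj : q₁.support.tail.Disjoint q₂.reverse.support.tail := by
    intro x hx₁ hx₂
    have hx₂' : x ∈ q₂.support := by simpa using List.mem_of_mem_tail hx₂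
    have hxp : x ∈ p.support := (hpv x).1
      ⟨SimpleGraph.Walk.mem_support_of_edges_subset hd₁.not_nil hperm₁.subset
        (by simp [List.mem_of_mem_tail hx₁]),
       SimpleGraph.Walk.mem_support_of_edges_subset hd₂.not_nil hperm₂.subset (by simp [hx₂'])⟩
    have hnd := hd₁.support_nodup
    rw [SimpleGraph.Walk.tail_support_append, List.nodup_append'] at hnd
    have hxu : x = u := ((SimpleGraph.Walk.mem_support_iff p).1 hxp).resolve_right
      fun hx ↦ hnd.2.2 hx hx₁
    have hnd₂ := hq₂.reverse.support_nodup
    rw [← SimpleGraph.Walk.cons_tail_support, List.nodup_cons] at hnd₂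
    exact hnd₂.1 (hxu ▸ hx₂)
  have hcycle : (q₁.append q₂.reverse).IsCycle := by
    rw [SimpleGraph.Walk.isCycle_def, SimpleGraph.Walk.isTrail_append]
    refine ⟨⟨hq₁.isTrail, hq₂.reverse.isTrail, by simpa using hedisj⟩, fun h ↦ ?_, ?_⟩
    · have hlen := congrArg SimpleGraph.Walk.length h
      rw [SimpleGraph.Walk.length_append, SimpleGraph.Walk.length_nil] at hlen
      exact huv (SimpleGraph.Walk.eq_of_length_eq_zero (p := q₁) (by omega)).symm
    · rw [SimpleGraph.Walk.tail_support_append, List.nodup_append']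
      exact ⟨hq₁.support_nodup.tail, hq₂.reverse.support_nodup.tail, hsdisj⟩
  have h₁ := hcyc _ _ hd₁
  have h₂ := hcyc _ _ hd₂
  have h₃ := hcyc _ _ hcycle
  simp only [SimpleGraph.Walk.length_append, SimpleGraph.Walk.length_reverse] at h₁ h₂ h₃
  rw [Nat.even_iff]
  omega
end
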